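/- Let k, m ∈ ℕ, let G₁, …, G_k be finitely generated groups, each with trivial center and each directly indecomposable (whenever N and M are normal subgroups of Gᵢ with N ∩ M = {1} and N·M = Gᵢ, then N = {1} or M = {1}), let A = ℤᵐ, and set G = G₁ × ⋯ × G_k × A. Fix finite generating sets Sᵢ of the Gᵢ, and let S be the induced finite generating set of G (the canonical copies of the Sᵢ together with the standard basis vectors of A and their inverses). Let χ be an automorphism of G mapping each canonical subgroup Hᵢ ≅ Gᵢ × A onto itself (where Hᵢ consists of the elements whose Gⱼ-coordinate is trivial for all j ≠ i). Then there exist automorphisms φᵢ of Gᵢ such that, writing V for the quotient of the abelianization of G by its torsion subgroup, q : G → V for the natural projection, χ̄ for the automorphism of V induced by χ, and equipping V with the word length |·| relative to q(S), there is a constant C ≥ 1 with: for every g = (g₁, …, g_k, a) ∈ G and every n ∈ ℕ, C⁻¹·(Σᵢ ‖φᵢⁿ(gᵢ)‖_{Sᵢ} + |χ̄ⁿ(q(g))|) ≤ ‖χⁿ(g)‖_S ≤ C·(Σᵢ ‖φᵢⁿ(gᵢ)‖_{Sᵢ} + |χ̄ⁿ(q(g))|). Moreover, for every g ∈ G with q(g)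 ≠ 0 there exist p ∈ ℕ and a real algebraic integer λ ≥ 1 such that the sequence n ↦ |χ̄ⁿ(q(g))| is bi-Lipschitz equivalent, for n ≥ 1, to n ↦ nᵖ·λⁿ. -/

import Mathlib

/-- The word length of `g ∈ G` with respect to a generating set `S ⊆ G`: the least `n` such
that `g` is a product of `n` elements of `S ∪ S⁻¹` (with the empty product giving `1`). -/
noncomputable def wordLength {G : Type*} [Group G] (S : Set G) (g : G) : ℕ :=
  sInf {n : ℕ | ∃ l : List G, l.length = n ∧ (∀ x ∈ l, x ∈ S ∨ x⁻¹ ∈ S) ∧ l.prod = g}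

/-- The conjugacy length of `g ∈ G`: the minimal word length of a conjugate of `g`. -/
noncomputable def conjLength {G : Type*} [Group G] (S : Set G) (g : G) : ℕ :=
  sInf (Set.range fun x : G => wordLength S (x * g * x⁻¹))

/-- The quotient of the abelianization of `G` by its torsion subgroup. -/
abbrev TorsionFreeAbelianization (G : Type*) [Group G] :=
  Abelianization G ⧸ CommGroup.torsion (Abelianization G)

/-- The natural projection of `G` onto the quotient of its abelianization by torsion. -/
def torsionFreeAbelianizationProj (G : Type*) [Group G] :
    G →* TorsionFreeAbelianization G :=
  (QuotientGroup.mk' (CommGroup.torsion (Abelianization G))).comp Abelianization.of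

open Filter Topology

/-- Sequences with positive terms whose quotient converges to a positive limit are bi-Lipschitz
equivalent. -/
theorem exists_bilipschitz_of_tendsto_div {a b : ℕ → ℝ} {c : ℝ} (hc : 0 < c)
    (ha : ∀ n, 1 ≤ n → 0 < a n) (hb : ∀ n, 1 ≤ n → 0 < b n)
    (h : Tendsto (fun n => a n / b n) atTop (𝓝 c)) :
    ∃ C : ℝ, 0 < C ∧ ∀ n, 1 ≤ n → a n ≤ C * b n ∧ b n ≤ C * a n := by
  obtain ⟨C₁, h₁⟩ := h.bddAbove_range
  obtain ⟨C₂, h₂⟩ := (h.inv₀ hc.ne').bddAbove_range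
  refine ⟨max 1 (max C₁ C₂), by positivity, fun n hn => ⟨?_, ?_⟩⟩
  · rw [← div_le_iff₀ (hb n hn)]
    exact (h₁ ⟨n, rfl⟩).trans ((le_max_left _ _).trans (le_max_right _ _))
  · rw [← div_le_iff₀ (ha n hn)]
    have : b n / a n ≤ C₂ := by simpa using h₂ ⟨n, rfl⟩
    exact this.trans ((le_max_right _ _).trans (le_max_right _ _))

theorem tendsto_choose_div_pow {j p : ℕ} (h : j ≤ p) :
    Tendsto (fun n : ℕ => (n.choose j : ℝ) / (n : ℝ) ^ p) atTop
      (𝓝 (if j = p then ((p.factorial : ℝ))⁻¹ else 0)) := by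
  have hpos : ∀ᶠ n : ℕ in atTop, (n : ℝ) ≠ 0 := by
    filter_upwards [eventually_gt_atTop 0] with n hn
    exact_mod_cast hn.ne'
  have key : Tendsto (fun n : ℕ => (n.choose j : ℝ) / (n : ℝ) ^ j) atTop
      (𝓝 ((j.factorial : ℝ))⁻¹) := by
    have h1 := (isEquivalent_choose j)
    rw [Asymptotics.isEquivalent_iff_tendsto_one] at h1
    · have h2 := h1.mul_const ((j.factorial : ℝ))⁻¹
      rw [one_mul] at h2
      refine h2.congr' ?_
      filter_upwards [hpos] with n hn
      have := Nat.factorial_ne_zero j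
      simp only [Pi.div_apply]
      field_simp
    · filter_upwards [hpos] with n hn
      have := Nat.factorial_ne_zero j
      positivity
  split_ifs with hjp
  · subst hjp; exact key
  · have h2 : Tendsto (fun n : ℕ => ((n : ℝ) ^ (p - j))⁻¹) atTop (𝓝 0) :=
      tendsto_inv_atTop_zero.comp
        ((tendsto_pow_atTop (by omega)).comp tendsto_natCast_atTop_atTop)
    have h3 := key.mul h2
    rw [mul_zero] at h3
    refine h3.congr' ?_
    filter_upwards [hpos] with n hn
    rw [div_mul_eq_mul_div, ← div_eq_mul_inv, div_div, ← pow_add, Nat.sub_add_cancel h]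

/-- The growth of the orbit of a generalized eigenvector. -/
theorem Module.End.exists_tendsto_norm_pow_div {W : Type*} [NormedAddCommGroup W]
    [NormedSpace ℂ W] (f : Module.End ℂ W) {μ : ℂ} (hμ : μ ≠ 0) {w : W}
    (hw : w ∈ f.maxGenEigenspace μ) (hw0 : w ≠ 0) :
    ∃ (p : ℕ) (c : ℝ), 0 < c ∧
      Tendsto (fun n : ℕ => ‖(f ^ n) w‖ / ((n : ℝ) ^ p * ‖μ‖ ^ n)) atTop (𝓝 c) := by
  classical
  rw [Module.End.mem_maxGenEigenspace] at hw
  set N : Module.End ℂ W := f - μ • 1 with hN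
  obtain ⟨p, hp⟩ : ∃ p, Nat.find hw = p + 1 := by
    refine Nat.exists_eq_succ_of_ne_zero fun h => hw0 ?_
    simpa [h] using Nat.find_spec hw
  have hNp : (N ^ p) w ≠ 0 := Nat.find_min hw (by omega)
  have hNlarge : ∀ j, p < j → (N ^ j) w = 0 := by
    intro j hj
    obtain ⟨i, rfl⟩ : ∃ i, j = i + (p + 1) := ⟨j - (p + 1), by omega⟩
    rw [pow_add, Module.End.mul_apply, ← hp, Nat.find_spec hw, map_zero]
  have hexp : ∀ n, p ≤ n → (f ^ n) w =
      ∑ j ∈ Finset.range (p + 1), ((n.choose j : ℂ) * μ ^ (n - j)) • (N ^ j) w := by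
    intro n hn
    have hf : f = N + μ • 1 := by simp [hN]
    have hcomm : Commute N (μ • (1 : Module.End ℂ W)) := (Commute.one_right N).smul_right μ
    rw [hf, hcomm.add_pow, LinearMap.sum_apply]
    symm
    rw [← Finset.sum_subset (Finset.range_subset_range.2 (Nat.succ_le_succ hn))]
    · refine Finset.sum_congr rfl fun j _ => ?_
      rw [smul_pow, one_pow, mul_smul_one, smul_mul_assoc, ← nsmul_eq_mul', LinearMap.smul_apply,
        LinearMap.smul_apply, ← Nat.cast_smul_eq_nsmul ℂ, smul_smul, mul_comm]
    · intro j _ hj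
      have : p < j := by simpa using hj
      rw [smul_pow, one_pow, mul_smul_one, smul_mul_assoc, ← nsmul_eq_mul', LinearMap.smul_apply,
        LinearMap.smul_apply, hNlarge j this, smul_zero, smul_zero]
  have hlim : Tendsto (fun n : ℕ => ((n : ℂ) ^ p * μ ^ n)⁻¹ • (f ^ n) w) atTop
      (𝓝 (((p.factorial : ℂ)⁻¹ * (μ ^ p)⁻¹) • (N ^ p) w)) := by
    have h1 : Tendsto (fun n : ℕ => ∑ j ∈ Finset.range (p + 1),
        ((((n.choose j : ℝ) / (n : ℝ) ^ p : ℝ) : ℂ) * (μ ^ j)⁻¹) • (N ^ j) w) atTop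
        (𝓝 (∑ j ∈ Finset.range (p + 1),
          (((if j = p then ((p.factorial : ℝ))⁻¹ else 0 : ℝ) : ℂ) * (μ ^ j)⁻¹) • (N ^ j) w)) := by
      refine tendsto_finsetSum _ fun j hj => ?_
      refine Tendsto.smul_const (Tendsto.mul_const _ ?_) _
      exact (Complex.continuous_ofReal.tendsto _).comp
        (tendsto_choose_div_pow (Nat.lt_succ_iff.1 (Finset.mem_range.1 hj)))
    have h2 : ∑ j ∈ Finset.range (p + 1),
          (((if j = p then ((p.factorial : ℝ))⁻¹ else 0 : ℝ) : ℂ) * (μ ^ j)⁻¹) • (N ^ j) w =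
        ((p.factorial : ℂ)⁻¹ * (μ ^ p)⁻¹) • (N ^ p) w := by
      rw [Finset.sum_eq_single p]
      · simp
      · intro j _ hj
        simp [hj]
      · simp
    rw [h2] at h1
    refine h1.congr' ?_
    filter_upwards [eventually_ge_atTop p] with n hn
    rw [hexp n hn, Finset.smul_sum]
    refine Finset.sum_congr rfl fun j hj => ?_
    have hj' : j ≤ n := (Nat.lt_succ_iff.1 (Finset.mem_range.1 hj)).trans hn
    rw [smul_smul]
    congr 1
    rw [pow_sub₀ _ hμ hj']
    push_cast
    have := pow_ne_zero n hμ
    have := pow_ne_zero j hμ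
    rw [mul_inv, div_eq_mul_inv]
    field_simp
  refine ⟨p, _, norm_pos_iff.2 (smul_ne_zero ?_ hNp), hlim.norm.congr fun n => ?_⟩
  · have := Nat.factorial_ne_zero p
    positivity
  · rw [norm_smul, norm_inv, norm_mul, norm_pow, norm_pow, Complex.norm_natCast, div_eq_inv_mul]

/-- Comparison of the sequences `n ^ p * r ^ n` in the lexicographic order of `(r, p)`. -/
theorem exists_pow_mul_pow_le {r s : ℝ} (hr : 0 < r) {p t : ℕ}
    (h : toLex (r, p) ≤ toLex (s, t)) :
    ∃ C : ℝ, 0 < C ∧ ∀ n : ℕ, 1 ≤ n → (n : ℝ) ^ p * r ^ n ≤ C * ((n : ℝ) ^ t * s ^ n) := by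
  rw [Prod.Lex.toLex_le_toLex] at h
  rcases h with h | ⟨h, h'⟩
  · simp only at h
    have hs := hr.trans h
    obtain ⟨C, hC⟩ := (tendsto_pow_const_mul_const_pow_of_lt_one p (r := r / s) (by positivity)
      ((div_lt_one hs).2 h)).bddAbove_range
    refine ⟨max C 1, by positivity, fun n hn => ?_⟩
    have h1 : (n : ℝ) ^ p * (r / s) ^ n ≤ C := hC ⟨n, rfl⟩
    have h2 : (n : ℝ) ^ p * r ^ n ≤ C * s ^ n := by
      rw [div_pow, mul_div_assoc', div_le_iff₀ (by positivity)] at h1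
      exact h1
    have h3 : (1 : ℝ) ≤ (n : ℝ) ^ t := one_le_pow₀ (by exact_mod_cast hn)
    calc _ ≤ C * s ^ n := h2
      _ ≤ max C 1 * (1 * s ^ n) := by rw [one_mul]; gcongr; exact le_max_left _ _
      _ ≤ _ := by gcongr
  · simp only at h h'
    subst h
    refine ⟨1, one_pos, fun n hn => ?_⟩
    rw [one_mul]
    have : (1 : ℝ) ≤ n := by exact_mod_cast hn
    gcongr

/-- Vectors in independent subspaces of a finite-dimensional space are bounded by their sum. -/
theorem exists_norm_le_mul_norm_sum {ι W : Type*} [NormedAddCommGroup W] [NormedSpace ℂ W]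
    [FiniteDimensional ℂ W] {E : ι → Submodule ℂ W} (hE : iSupIndep E) (s : Finset ι) :
    ∃ K : ℝ, 0 < K ∧ ∀ w : ι → W, (∀ i ∈ s, w i ∈ E i) → ∀ i ∈ s, ‖w i‖ ≤ K * ‖∑ j ∈ s, w j‖ := by
  classical
  let F : (∀ i : s, E i) →ₗ[ℂ] W := ∑ i : s, (E i).subtype ∘ₗ LinearMap.proj i
  have hF : ∀ x, F x = ∑ i : s, (x i : W) := fun x => by simp [F]
  have hker : LinearMap.ker F = ⊥ := by
    refine LinearMap.ker_eq_bot'.2 fun x hx => ?_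
    rw [hF] at hx
    have := (iSupIndep_iff_finsetSum_eq_zero_imp_eq_zero _).1 (hE.comp Subtype.val_injective)
      (Finset.univ : Finset s) (fun i => (x i : W)) (fun i _ => (x i).2) hx
    funext i
    exact Subtype.ext (this i (Finset.mem_univ _))
  obtain ⟨K, hK, hanti⟩ := F.exists_antilipschitzWith hker
  refine ⟨K, by exact_mod_cast hK, fun w hw i hi => ?_⟩
  let x : ∀ i : s, E i := fun i => ⟨w i, hw i i.2⟩
  have h1 := ZeroHomClass.bound_of_antilipschitz F hanti x
  rw [hF, Finset.sum_coe_sort s w] at h1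
  exact (norm_le_pi_norm x ⟨i, hi⟩).trans h1

/-- The orbit of a nonzero vector under an injective endomorphism grows like `n ^ p * ‖μ‖ ^ n` for
some eigenvalue `μ`. -/
theorem Module.End.exists_bilipschitz_norm_pow_apply {W : Type*} [NormedAddCommGroup W]
    [NormedSpace ℂ W] [FiniteDimensional ℂ W] (f : Module.End ℂ W) (hf : Function.Injective f)
    {v : W} (hv : v ≠ 0) :
    ∃ (p : ℕ) (μ : ℂ), f.HasEigenvalue μ ∧ ∃ C : ℝ, 0 < C ∧ ∀ n : ℕ, 1 ≤ n →
      ‖(f ^ n) v‖ ≤ C * ((n : ℝ) ^ p * ‖μ‖ ^ n) ∧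
      (n : ℝ) ^ p * ‖μ‖ ^ n ≤ C * ‖(f ^ n) v‖ := by
  classical
  have hinj : ∀ n : ℕ, Function.Injective ⇑(f ^ n) := fun n => by
    rw [Module.End.coe_pow]; exact hf.iterate n
  obtain ⟨w, hwE, hwsum⟩ := (Submodule.mem_iSup_iff_exists_finsupp f.maxGenEigenspace v).1
    (by rw [Module.End.iSup_maxGenEigenspace_eq_top]; trivial)
  have hsum : ∑ μ ∈ w.support, w μ = v := hwsum
  have hne : ∀ μ ∈ w.support, w μ ≠ 0 := fun μ hμ => Finsupp.mem_support_iff.1 hμ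
  have heig : ∀ μ ∈ w.support, f.HasEigenvalue μ := fun μ hμ => by
    refine Module.End.HasUnifEigenvalue.lt (k := ⊤) zero_lt_one fun h => hne μ hμ ?_
    have hmem : w μ ∈ f.genEigenspace μ ⊤ := hwE μ
    rwa [h, Submodule.mem_bot] at hmem
  have hμ0 : ∀ μ ∈ w.support, μ ≠ 0 := by
    rintro μ hμ rfl
    obtain ⟨u, hu⟩ := (heig 0 hμ).exists_hasEigenvector
    exact hu.2 (hf (by simpa using hu.apply_eq_smul))
  have hcomp : ∀ μ : ℂ, ∃ (p : ℕ) (C : ℝ), 0 < C ∧ (μ ∈ w.support → ∀ n : ℕ, 1 ≤ n →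
      ‖(f ^ n) (w μ)‖ ≤ C * ((n : ℝ) ^ p * ‖μ‖ ^ n) ∧
      (n : ℝ) ^ p * ‖μ‖ ^ n ≤ C * ‖(f ^ n) (w μ)‖) := fun μ => by
    by_cases hμ : μ ∈ w.support
    · obtain ⟨p, c, hc, hlim⟩ := f.exists_tendsto_norm_pow_div (hμ0 μ hμ) (hwE μ) (hne μ hμ)
      obtain ⟨C, hC, h⟩ := exists_bilipschitz_of_tendsto_div hc
        (fun n _ => norm_pos_iff.2 fun h => hne μ hμ (hinj n (by rw [h, map_zero])))
        (fun n hn => by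
          have := norm_pos_iff.2 (hμ0 μ hμ)
          have : (0 : ℝ) < n := by exact_mod_cast hn
          positivity) hlim
      exact ⟨p, C, hC, fun _ => h⟩
    · exact ⟨0, 1, one_pos, fun h => absurd h hμ⟩
  choose p C hC hpC using hcomp
  have hnonempty : w.support.Nonempty := by
    rw [Finset.nonempty_iff_ne_empty]
    intro h
    rw [h, Finset.sum_empty] at hsum
    exact hv hsum.symm
  obtain ⟨μ, hμ, hmax⟩ := w.support.exists_max_image (fun μ => toLex (‖μ‖, p μ)) hnonempty
  have hdom : ∀ ν : ℂ, ∃ D : ℝ, 0 < D ∧ (ν ∈ w.support → ∀ n : ℕ, 1 ≤ n →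
      (n : ℝ) ^ p ν * ‖ν‖ ^ n ≤ D * ((n : ℝ) ^ p μ * ‖μ‖ ^ n)) := fun ν => by
    by_cases hν : ν ∈ w.support
    · obtain ⟨D, hD, h⟩ := exists_pow_mul_pow_le (norm_pos_iff.2 (hμ0 ν hν)) (hmax ν hν)
      exact ⟨D, hD, fun _ => h⟩
    · exact ⟨1, one_pos, fun h => absurd h hν⟩
  choose D hD hpD using hdom
  obtain ⟨K, hK, hKw⟩ := exists_norm_le_mul_norm_sum f.independent_maxGenEigenspace w.support
  have hpow : ∀ n, (f ^ n) v = ∑ ν ∈ w.support, (f ^ n) (w ν) := fun n => by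
    rw [← map_sum, hsum]
  have hmaps : ∀ n ν, (f ^ n) (w ν) ∈ f.maxGenEigenspace ν := fun n ν =>
    Module.End.mapsTo_maxGenEigenspace_of_comm ((Commute.refl f).pow_right n) ν (hwE ν)
  have hsum0 : 0 ≤ ∑ ν ∈ w.support, C ν * D ν :=
    Finset.sum_nonneg fun ν _ => (mul_pos (hC ν) (hD ν)).le
  have hCK : 0 < C μ * K := mul_pos (hC μ) hK
  refine ⟨p μ, μ, heig μ hμ, ∑ ν ∈ w.support, C ν * D ν + C μ * K, by positivity,
    fun n hn => ⟨?_, ?_⟩⟩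
  · have hpos : 0 ≤ (n : ℝ) ^ p μ * ‖μ‖ ^ n := by positivity
    calc ‖(f ^ n) v‖ ≤ ∑ ν ∈ w.support, ‖(f ^ n) (w ν)‖ := by
          rw [hpow]; exact norm_sum_le _ _
      _ ≤ ∑ ν ∈ w.support, C ν * D ν * ((n : ℝ) ^ p μ * ‖μ‖ ^ n) := by
          refine Finset.sum_le_sum fun ν hν => ((hpC ν hν n hn).1).trans ?_
          rw [mul_assoc]
          exact mul_le_mul_of_nonneg_left (hpD ν hν n hn) (hC ν).le
      _ ≤ _ := by
          rw [← Finset.sum_mul]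
          gcongr
          linarith
  · calc (n : ℝ) ^ p μ * ‖μ‖ ^ n ≤ C μ * ‖(f ^ n) (w μ)‖ := (hpC μ hμ n hn).2
      _ ≤ C μ * (K * ‖(f ^ n) v‖) := by
          rw [hpow]
          exact mul_le_mul_of_nonneg_left
            (hKw (fun ν => (f ^ n) (w ν)) (fun ν _ => hmaps n ν) μ hμ) (hC μ).le
      _ ≤ _ := by
          rw [← mul_assoc]
          gcongr
          linarith

section WordLength

variable {G H : Type*} [Group G] [Group H]

theorem exists_list_wordLength {S : Set G} (hS : Subgroup.closure S = ⊤) (g : G) :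
    ∃ l : List G, l.length = wordLength S g ∧ (∀ x ∈ l, x ∈ S ∨ x⁻¹ ∈ S) ∧ l.prod = g := by
  refine Nat.sInf_mem
    (s := {n : ℕ | ∃ l : List G, l.length = n ∧ (∀ x ∈ l, x ∈ S ∨ x⁻¹ ∈ S) ∧ l.prod = g}) ?_
  have hg : g ∈ (Subgroup.closure S).toSubmonoid := hS ▸ trivial
  rw [Subgroup.closure_toSubmonoid] at hg
  obtain ⟨l, hl, hprod⟩ := Submonoid.exists_list_of_mem_closure hg
  exact ⟨l.length, l, rfl, hl, hprod⟩

theorem wordLength_prod_le {S : Set G} (l : List G) (hl : ∀ x ∈ l, x ∈ S ∨ x⁻¹ ∈ S) :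
    wordLength S l.prod ≤ l.length :=
  Nat.sInf_le ⟨l, rfl, hl, rfl⟩

theorem wordLength_one (S : Set G) : wordLength S (1 : G) = 0 :=
  Nat.le_zero.1 (wordLength_prod_le (S := S) [] (by simp))

theorem wordLength_mul_le {S : Set G} (hS : Subgroup.closure S = ⊤) (g h : G) :
    wordLength S (g * h) ≤ wordLength S g + wordLength S h := by
  obtain ⟨l, hl, hlS, rfl⟩ := exists_list_wordLength hS g
  obtain ⟨l', hl', hlS', rfl⟩ := exists_list_wordLength hS h
  rw [← hl, ← hl', ← List.prod_append, ← List.length_append]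
  refine wordLength_prod_le _ fun x hx => ?_
  rcases List.mem_append.1 hx with hx | hx
  exacts [hlS x hx, hlS' x hx]

theorem wordLength_inv_le {S : Set G} (hS : Subgroup.closure S = ⊤) (g : G) :
    wordLength S g⁻¹ ≤ wordLength S g := by
  obtain ⟨l, hl, hlS, rfl⟩ := exists_list_wordLength hS g
  rw [← hl, List.prod_inv_reverse]
  refine (wordLength_prod_le _ fun x hx => ?_).trans (by simp)
  obtain ⟨y, hy, rfl⟩ : ∃ y ∈ l, y⁻¹ = x := by simpa using hx
  rw [inv_inv]
  exact (hlS y hy).symm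

theorem wordLength_pow_le {S : Set G} (hS : Subgroup.closure S = ⊤) (g : G) (n : ℕ) :
    wordLength S (g ^ n) ≤ n * wordLength S g := by
  induction n with
  | zero => simp [wordLength_one]
  | succ n ih =>
    rw [pow_succ, Nat.succ_mul]
    exact (wordLength_mul_le hS _ _).trans (by gcongr)

theorem wordLength_zpow_le {S : Set G} (hS : Subgroup.closure S = ⊤) (g : G) (n : ℤ) :
    wordLength S (g ^ n) ≤ n.natAbs * wordLength S g := by
  rcases Int.natAbs_eq n with h | h
  · conv_lhs => rw [h, zpow_natCast]
    exact wordLength_pow_le hS g _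
  · conv_lhs => rw [h, zpow_neg, zpow_natCast]
    exact (wordLength_inv_le hS _).trans (wordLength_pow_le hS g _)

/-- A homomorphism sending generators to generators or to the identity does not increase word
length. -/
theorem wordLength_map_le {S : Set G} {T : Set H} (hS : Subgroup.closure S = ⊤) (f : G →* H)
    (hf : ∀ s ∈ S, f s ∈ T ∨ f s = 1) (g : G) : wordLength T (f g) ≤ wordLength S g := by
  classical
  obtain ⟨l, hl, hlS, rfl⟩ := exists_list_wordLength hS g
  rw [← hl]
  clear hl
  suffices h : ∃ l' : List H, l'.length ≤ l.length ∧ (∀ x ∈ l', x ∈ T ∨ x⁻¹ ∈ T) ∧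
      l'.prod = f l.prod by
    obtain ⟨l', h1, h2, h3⟩ := h
    exact h3 ▸ (wordLength_prod_le l' h2).trans h1
  induction l with
  | nil => exact ⟨[], by simp⟩
  | cons a l ih =>
    obtain ⟨l', h1, h2, h3⟩ := ih fun x hx => hlS x (List.mem_cons_of_mem _ hx)
    have ha : (f a ∈ T ∨ (f a)⁻¹ ∈ T) ∨ f a = 1 := by
      rcases hlS a List.mem_cons_self with h | h
      · rcases hf a h with h | h <;> simp [h]
      · rcases hf _ h with h | h
        · exact Or.inl (Or.inr (by simpa using h))
        · exact Or.inr (by simpa using h)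
    rcases ha with ha | ha
    · refine ⟨f a :: l', by simpa using h1, fun x hx => ?_, by simp [h3]⟩
      rcases List.mem_cons.1 hx with rfl | hx
      exacts [ha, h2 x hx]
    · exact ⟨l', h1.trans (by simp), h2, by simp [h3, ha]⟩

theorem exists_conjLength_eq (S : Set G) (g : G) :
    ∃ x : G, wordLength S (x * g * x⁻¹) = conjLength S g :=
  Nat.sInf_mem (Set.range_nonempty fun x : G => wordLength S (x * g * x⁻¹))

theorem conjLength_le (S : Set G) (g x : G) : conjLength S g ≤ wordLength S (x * g * x⁻¹) :=
  Nat.sInf_le ⟨x, rfl⟩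

theorem conjLength_map_le {S : Set G} {T : Set H} (hS : Subgroup.closure S = ⊤) (f : G →* H)
    (hf : ∀ s ∈ S, f s ∈ T ∨ f s = 1) (g : G) : conjLength T (f g) ≤ conjLength S g := by
  obtain ⟨x, hx⟩ := exists_conjLength_eq S g
  rw [← hx]
  refine (conjLength_le T (f g) (f x)).trans ?_
  simpa using wordLength_map_le hS f hf (x * g * x⁻¹)

theorem conjLength_eq_wordLength {A : Type*} [CommGroup A] (S : Set A) (a : A) :
    conjLength S a = wordLength S a := by
  obtain ⟨x, hx⟩ := exists_conjLength_eq S a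
  rw [← hx, mul_right_comm, mul_inv_cancel, one_mul]

theorem wordLength_finsetProd_zpow_le {A ι : Type*} [CommGroup A] {S : Set A}
    (hS : Subgroup.closure S = ⊤) (s : Finset ι) (x : ι → A) (n : ι → ℤ) :
    wordLength S (∏ i ∈ s, x i ^ n i) ≤ ∑ i ∈ s, (n i).natAbs * wordLength S (x i) := by
  classical
  induction s using Finset.induction_on with
  | empty => simp [wordLength_one]
  | insert j s hj ih =>
    rw [Finset.prod_insert hj, Finset.sum_insert hj]
    exact (wordLength_mul_le hS _ _).trans (add_le_add (wordLength_zpow_le hS _ _) ih)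

/-- A homomorphism to a normed group is Lipschitz for the word length of a finite generating
set. -/
theorem exists_norm_le_mul_wordLength {E : Type*} [NormedAddCommGroup E] {S : Set G}
    (hfin : S.Finite) (hS : Subgroup.closure S = ⊤) (F : Additive G →+ E) :
    ∃ K : ℝ, 0 < K ∧ ∀ g : G, ‖F (Additive.ofMul g)‖ ≤ K * wordLength S g := by
  obtain ⟨K, hK⟩ := (hfin.image fun s => ‖F (Additive.ofMul s)‖).bddAbove
  refine ⟨max K 1, by positivity, fun g => ?_⟩
  obtain ⟨l, hl, hlS, rfl⟩ := exists_list_wordLength hS g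
  rw [← hl]
  clear hl
  induction l with
  | nil => simp
  | cons a l ih =>
    have ha : ‖F (Additive.ofMul a)‖ ≤ max K 1 := by
      rcases hlS a List.mem_cons_self with h | h
      · exact (hK ⟨a, h, rfl⟩).trans (le_max_left _ _)
      · refine le_trans ?_ ((hK ⟨_, h, rfl⟩).trans (le_max_left _ _))
        simp
    rw [List.prod_cons, ofMul_mul, map_add, List.length_cons]
    push_cast
    have := ih fun x hx => hlS x (List.mem_cons_of_mem _ hx)
    linarith [norm_add_le (F (Additive.ofMul a)) (F (Additive.ofMul l.prod))]

end WordLength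

section Product

variable {ι : Type*} [DecidableEq ι] {G : ι → Type*} [∀ i, Group (G i)]

theorem wordLength_pi_prod_le [Fintype ι] {A : Type*} [Group A] {Si : ∀ i, Set (G i)} {T : Set A}
    {S : Set ((∀ i, G i) × A)} (hSi : ∀ i, Subgroup.closure (Si i) = ⊤)
    (hT : Subgroup.closure T = ⊤) (hS : Subgroup.closure S = ⊤)
    (hSiS : ∀ i, ∀ s ∈ Si i, (Pi.mulSingle i s, 1) ∈ S) (hTS : ∀ t ∈ T, (1, t) ∈ S)
    (u : ∀ i, G i) (a : A) :
    wordLength S (u, a) ≤ ∑ i, wordLength (Si i) (u i) + wordLength T a := by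
  have hfac : ∀ s : Finset ι, wordLength S ((fun i => if i ∈ s then u i else 1 : ∀ i, G i), 1) ≤
      ∑ i ∈ s, wordLength (Si i) (u i) := fun s => by
    induction s using Finset.induction_on with
    | empty =>
      refine (le_of_eq ?_).trans (Nat.zero_le _)
      exact wordLength_one S
    | insert j s hj ih =>
      have h : (((fun i => if i ∈ insert j s then u i else 1 : ∀ i, G i), 1) :
          (∀ i, G i) × A) =
          (Pi.mulSingle j (u j), 1) * ((fun i => if i ∈ s then u i else 1 : ∀ i, G i), 1) := by
        refine Prod.ext (funext fun i => ?_) (by simp)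
        by_cases hij : i = j
        · subst hij; simp [hj]
        · simp [hij]
      rw [h, Finset.sum_insert hj]
      refine (wordLength_mul_le hS _ _).trans (add_le_add ?_ ih)
      exact wordLength_map_le (hSi j)
        ((MonoidHom.inl (∀ i, G i) A).comp (MonoidHom.mulSingle G j))
        (fun s hs => Or.inl (hSiS j s hs)) (u j)
  have h : (u, a) = (u, 1) * ((1 : ∀ i, G i), a) := by simp
  rw [h]
  refine (wordLength_mul_le hS _ _).trans (add_le_add ?_ ?_)
  · simpa using hfac Finset.univ
  · exact wordLength_map_le hT (MonoidHom.inr (∀ i, G i) A) (fun t ht => Or.inl (hTS t ht)) a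

theorem conjLength_pi_prod_le [Fintype ι] {A : Type*} [CommGroup A] {Si : ∀ i, Set (G i)}
    {T : Set A} {S : Set ((∀ i, G i) × A)} (hSi : ∀ i, Subgroup.closure (Si i) = ⊤)
    (hT : Subgroup.closure T = ⊤) (hS : Subgroup.closure S = ⊤)
    (hSiS : ∀ i, ∀ s ∈ Si i, (Pi.mulSingle i s, 1) ∈ S) (hTS : ∀ t ∈ T, (1, t) ∈ S)
    (g : (∀ i, G i) × A) :
    conjLength S g ≤ ∑ i, conjLength (Si i) (g.1 i) + wordLength T g.2 := by
  choose x hx using fun i => exists_conjLength_eq (Si i) (g.1 i)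
  refine (conjLength_le S g (x, 1)).trans ?_
  simp_rw [← hx]
  have h : (x, 1) * g * (x, 1)⁻¹ = (x * g.1 * x⁻¹, g.2) := by
    refine Prod.ext rfl ?_
    simp
  rw [h]
  exact wordLength_pi_prod_le hSi hT hS hSiS hTS _ _

theorem closure_pi_prod_eq_top [Finite ι] {A : Type*} [Group A] {Si : ∀ i, Set (G i)} {T : Set A}
    {S : Set ((∀ i, G i) × A)} (hSi : ∀ i, Subgroup.closure (Si i) = ⊤)
    (hT : Subgroup.closure T = ⊤) (hSiS : ∀ i, ∀ s ∈ Si i, (Pi.mulSingle i s, 1) ∈ S)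
    (hTS : ∀ t ∈ T, (1, t) ∈ S) : Subgroup.closure S = ⊤ := by
  have h1 : (Subgroup.closure S).comap (MonoidHom.inl (∀ i, G i) A) = ⊤ := by
    rw [eq_top_iff]
    intro u _
    refine Subgroup.pi_mem_of_mulSingle_mem u fun i => ?_
    have : (⊤ : Subgroup (G i)) ≤ (Subgroup.closure S).comap
        ((MonoidHom.inl (∀ i, G i) A).comp (MonoidHom.mulSingle G i)) := by
      rw [← hSi i, Subgroup.closure_le]
      exact fun s hs => Subgroup.subset_closure (hSiS i s hs)
    exact this (Subgroup.mem_top (u i))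
  have h2 : (Subgroup.closure S).comap (MonoidHom.inr (∀ i, G i) A) = ⊤ := by
    rw [eq_top_iff, ← hT, Subgroup.closure_le]
    exact fun t ht => Subgroup.subset_closure (hTS t ht)
  rw [eq_top_iff]
  rintro ⟨u, a⟩ _
  have h : (u, a) = (u, 1) * ((1 : ∀ i, G i), a) := by simp
  rw [h]
  have hu : u ∈ (Subgroup.closure S).comap (MonoidHom.inl (∀ i, G i) A) := h1 ▸ trivial
  have ha : a ∈ (Subgroup.closure S).comap (MonoidHom.inr (∀ i, G i) A) := h2 ▸ trivial
  exact mul_mem hu ha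

end Product

theorem isIntegral_int_norm {μ : ℂ} (hμ : IsIntegral ℤ μ) : IsIntegral ℤ ‖μ‖ := by
  have hconj : IsIntegral ℤ ((starRingEnd ℂ) μ) := hμ.map ((starRingEnd ℂ).toIntAlgHom)
  have h : IsIntegral ℤ ((‖μ‖ : ℂ) ^ 2) := by
    rw [← Complex.mul_conj']
    exact hμ.mul hconj
  exact (isIntegral_algebraMap_iff (algebraMap ℝ ℂ).injective).1 (h.of_pow two_pos)

/-- The word length of the orbit of a nontrivial element of a finitely generated free abelian group
under an automorphism grows like `n ^ p * lam ^ n` for some algebraic integer `lam ≥ 1`. -/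
theorem exists_bilipschitz_wordLength_iterate {V : Type*} [CommGroup V] [IsMulTorsionFree V]
    {T : Set V} (hfin : T.Finite) (hT : Subgroup.closure T = ⊤) (χ : V ≃* V) {v : V} (hv : v ≠ 1) :
    ∃ (p : ℕ) (lam : ℝ), 1 ≤ lam ∧ IsIntegral ℤ lam ∧
      ∃ C : ℝ, 0 < C ∧ ∀ n : ℕ, 1 ≤ n →
        (wordLength T ((⇑χ)^[n] v) : ℝ) ≤ C * ((n : ℝ) ^ p * lam ^ n) ∧
        (n : ℝ) ^ p * lam ^ n ≤ C * (wordLength T ((⇑χ)^[n] v) : ℝ) := by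
  classical
  have hFG : Group.FG V := ⟨⟨hfin.toFinset, by simpa using hT⟩⟩
  have : Module.Finite ℤ (Additive V) := Module.Finite.iff_addGroup_fg.2 inferInstance
  let b := Module.Free.chooseBasis ℤ (Additive V)
  let ι := Module.Free.ChooseBasisIndex ℤ (Additive V)
  let castHom := Int.castRingHom ℂ
  let emb : Additive V →+ (ι → ℂ) :=
    { toFun := fun x i => (b.repr x i : ℂ)
      map_zero' := by ext; simp
      map_add' := fun x y => by ext; simp }
  have hemb : ∀ x i, emb x i = (b.repr x i : ℂ) := fun x i => rfl
  let lin : (V ≃* V) → (Additive V →ₗ[ℤ] Additive V) := fun ψ =>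
    (MonoidHom.toAdditive ψ.toMonoidHom).toIntLinearMap
  have hlin : ∀ ψ x, lin ψ (Additive.ofMul x) = Additive.ofMul (ψ x) := fun ψ x => rfl
  let mat : (V ≃* V) → Matrix ι ι ℤ := fun ψ => LinearMap.toMatrix b b (lin ψ)
  let f : Module.End ℂ (ι → ℂ) := Matrix.toLin' ((mat χ).map castHom)
  have hmat : mat χ.symm * mat χ = 1 := by
    have : lin χ.symm ∘ₗ lin χ = LinearMap.id := by
      ext x
      exact congrArg Additive.ofMul (χ.symm_apply_apply x.toMul)
    rw [← LinearMap.toMatrix_comp b b b, this, LinearMap.toMatrix_id]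
  have hf : Function.Injective f := by
    refine Function.LeftInverse.injective (g := Matrix.toLin' ((mat χ.symm).map castHom)) fun x => ?_
    rw [← LinearMap.comp_apply, ← Matrix.toLin'_mul, ← Matrix.map_mul, hmat]
    simp
  have hfemb : ∀ x : V, f (emb (Additive.ofMul x)) = emb (Additive.ofMul (χ x)) := fun x => by
    ext i
    have h := congrFun (LinearMap.toMatrix_mulVec_repr b b (lin χ) (Additive.ofMul x)) i
    rw [hlin] at h
    rw [hemb, ← h]
    simp [f, mat, Matrix.mulVec, dotProduct, hemb, castHom]
    rfl
  have hiter : ∀ n x, (f ^ n) (emb (Additive.ofMul x)) = emb (Additive.ofMul ((⇑χ)^[n] x)) := by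
    intro n x
    induction n with
    | zero => simp
    | succ n ih => rw [pow_succ', Module.End.mul_apply, ih, hfemb, Function.iterate_succ_apply']
  have hone : ∀ x : V, x ≠ 1 → 1 ≤ ‖emb (Additive.ofMul x)‖ := fun x hx => by
    obtain ⟨i, hi⟩ : ∃ i, b.repr (Additive.ofMul x) i ≠ 0 := by
      by_contra! h
      exact hx (by simpa using b.repr.map_eq_zero_iff.1 (Finsupp.ext h))
    refine le_trans ?_ (norm_le_pi_norm _ i)
    rw [hemb, Complex.norm_intCast]
    exact_mod_cast Int.one_le_abs hi
  have hχv : ∀ n, (⇑χ)^[n] v ≠ 1 := fun n h =>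
    hv (χ.injective.iterate n (by rw [h, Function.iterate_fixed (map_one χ)]))
  obtain ⟨K, hK, hKle⟩ := exists_norm_le_mul_wordLength hfin hT emb
  obtain ⟨L, hL, hLle⟩ : ∃ L : ℝ, 0 < L ∧
      ∀ x : V, (wordLength T x : ℝ) ≤ L * ‖emb (Additive.ofMul x)‖ := by
    refine ⟨∑ i, (wordLength T (b i).toMul : ℝ) + 1, by positivity, fun x => ?_⟩
    have hx : x = ∏ i, (b i).toMul ^ (b.repr (Additive.ofMul x) i) := by
      apply Additive.ofMul.injective
      simp [ofMul_prod, b.sum_repr]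
    have h1 := wordLength_finsetProd_zpow_le hT Finset.univ (fun i => (b i).toMul)
      (fun i => b.repr (Additive.ofMul x) i)
    rw [← hx] at h1
    calc (wordLength T x : ℝ)
        ≤ ∑ i, ((b.repr (Additive.ofMul x) i).natAbs : ℝ) * (wordLength T (b i).toMul : ℝ) := by
          exact_mod_cast h1
      _ ≤ ∑ i, ‖emb (Additive.ofMul x)‖ * (wordLength T (b i).toMul : ℝ) := by
          refine Finset.sum_le_sum fun i _ => mul_le_mul_of_nonneg_right ?_ (Nat.cast_nonneg _)
          refine le_trans (le_of_eq ?_) (norm_le_pi_norm _ i)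
          rw [hemb, Complex.norm_intCast, Nat.cast_natAbs, Int.cast_abs]
      _ ≤ _ := by
          rw [← Finset.mul_sum, mul_comm]
          gcongr
          linarith
  have hv0 : emb (Additive.ofMul v) ≠ 0 := by
    have := hone v hv
    exact norm_pos_iff.1 (by linarith)
  obtain ⟨p, μ, hμ, C, hC, hbound⟩ := f.exists_bilipschitz_norm_pow_apply hf hv0
  have hμint : IsIntegral ℤ μ := by
    refine ⟨(mat χ).charpoly, Matrix.charpoly_monic _, ?_⟩
    have h := (Module.End.hasEigenvalue_iff_isRoot_charpoly f μ).1 hμ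
    rw [Matrix.charpoly_toLin', Matrix.charpoly_map, Polynomial.IsRoot.def,
      Polynomial.eval_map] at h
    exact h
  have hμ1 : 1 ≤ ‖μ‖ := by
    by_contra! hlt
    have hlim := (tendsto_pow_const_mul_const_pow_of_lt_one p (norm_nonneg μ) hlt).const_mul C
    rw [mul_zero] at hlim
    obtain ⟨n, hn, hn1⟩ := ((hlim.eventually_lt_const one_pos).and (eventually_ge_atTop 1)).exists
    have h1 := (hbound n hn1).1
    rw [hiter] at h1
    exact absurd (hone _ (hχv n)) (by linarith)
  refine ⟨p, ‖μ‖, hμ1, isIntegral_int_norm hμint, L * C + C * K, by positivity, fun n hn => ?_⟩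
  obtain ⟨h1, h2⟩ := hbound n hn
  rw [hiter] at h1 h2
  have hpos : 0 ≤ (n : ℝ) ^ p * ‖μ‖ ^ n := by positivity
  constructor
  · calc (wordLength T ((⇑χ)^[n] v) : ℝ) ≤ L * (C * ((n : ℝ) ^ p * ‖μ‖ ^ n)) :=
          (hLle _).trans (mul_le_mul_of_nonneg_left h1 hL.le)
      _ ≤ _ := by
          rw [← mul_assoc]
          exact mul_le_mul_of_nonneg_right (by linarith [mul_pos hC hK]) hpos
  · calc (n : ℝ) ^ p * ‖μ‖ ^ n ≤ C * (K * (wordLength T ((⇑χ)^[n] v) : ℝ)) :=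
          h2.trans (mul_le_mul_of_nonneg_left (hKle _) hC.le)
      _ ≤ _ := by
          rw [← mul_assoc]
          exact mul_le_mul_of_nonneg_right (by linarith [mul_pos hL hC]) (Nat.cast_nonneg _)

section Factors

variable {ι : Type*} [DecidableEq ι] {G : ι → Type*} [∀ i, Group (G i)] {A : Type*} [CommGroup A]

/-- An automorphism of `(∏ i, G i) × A` preserving the subgroup `G i × A` is compatible with the
projection to `G i` if `G i` has trivial center. -/
theorem apply_fst_eq_one_of_fst_eq_one {i : ι} (hcenter : Subgroup.center (G i) = ⊥)
    (χ : ((∀ i, G i) × A) ≃* ((∀ i, G i) × A))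
    (hχ : ∀ x : (∀ i, G i) × A, (∀ j, j ≠ i → x.1 j = 1) → ∀ j, j ≠ i → (χ.symm x).1 j = 1)
    {g : (∀ i, G i) × A} (hg : g.1 i = 1) : (χ g).1 i = 1 := by
  rw [← Subgroup.mem_bot, ← hcenter, Subgroup.mem_center_iff]
  intro y
  obtain ⟨h, hh, hy⟩ : ∃ h : (∀ i, G i) × A, (∀ j, j ≠ i → h.1 j = 1) ∧
      χ h = (Pi.mulSingle i y, 1) :=
    ⟨χ.symm (Pi.mulSingle i y, 1), hχ _ fun j hj => by simp [hj], χ.apply_symm_apply _⟩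
  have hcomm : h * g = g * h := by
    refine Prod.ext (funext fun j => ?_) (mul_comm _ _)
    by_cases hj : j = i
    · subst hj; simp [hg]
    · simp [hh j hj]
  simpa [hy] using congrFun (congrArg Prod.fst (congrArg χ hcomm)) i

/-- The endomorphism of `G i` induced by an automorphism of `(∏ i, G i) × A`. -/
def factorHom (χ : ((∀ i, G i) × A) ≃* ((∀ i, G i) × A)) (i : ι) : G i →* G i :=
  (Pi.evalMonoidHom G i).comp ((MonoidHom.fst _ _).comp
    (χ.toMonoidHom.comp ((MonoidHom.inl (∀ i, G i) A).comp (MonoidHom.mulSingle G i))))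

theorem apply_fst_eq_factorHom {i : ι} (hcenter : Subgroup.center (G i) = ⊥)
    (χ : ((∀ i, G i) × A) ≃* ((∀ i, G i) × A))
    (hχ : ∀ x : (∀ i, G i) × A, (∀ j, j ≠ i → x.1 j = 1) → ∀ j, j ≠ i → (χ.symm x).1 j = 1)
    (g : (∀ i, G i) × A) : (χ g).1 i = factorHom χ i (g.1 i) := by
  have h := apply_fst_eq_one_of_fst_eq_one hcenter χ hχ
    (g := (Pi.mulSingle i (g.1 i), 1)⁻¹ * g) (by simp)
  rw [map_mul, map_inv] at h
  exact (inv_mul_eq_one.1 h).symm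

/-- An automorphism of `(∏ i, G i) × A` preserving each `G i × A` induces automorphisms of the
factors `G i` with trivial center. -/
theorem exists_mulEquiv_apply_fst_eq (hcenter : ∀ i, Subgroup.center (G i) = ⊥)
    (χ : ((∀ i, G i) × A) ≃* ((∀ i, G i) × A))
    (hχ : ∀ i, ⇑χ '' {x : (∀ i, G i) × A | ∀ j, j ≠ i → x.1 j = 1} =
      {x : (∀ i, G i) × A | ∀ j, j ≠ i → x.1 j = 1}) :
    ∃ φ : ∀ i, G i ≃* G i, ∀ g i, (χ g).1 i = φ i (g.1 i) := by
  have hsymm : ∀ i, ∀ x : (∀ i, G i) × A, (∀ j, j ≠ i → x.1 j = 1) →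
      ∀ j, j ≠ i → (χ.symm x).1 j = 1 := fun i x hx => by
    obtain ⟨y, hy, rfl⟩ := (hχ i).ge hx
    rw [χ.symm_apply_apply]
    exact hy
  have hfun := fun i => apply_fst_eq_factorHom (hcenter i) χ (hsymm i)
  have hfun' := fun i => apply_fst_eq_factorHom (hcenter i) χ.symm
    fun x hx => (hχ i).le ⟨x, hx, rfl⟩
  refine ⟨fun i => (factorHom χ i).toMulEquiv (factorHom χ.symm i) ?_ ?_, fun g i => hfun i g⟩
  · ext x
    have h := hfun' i (χ (Pi.mulSingle i x, 1))
    rw [hfun i, χ.symm_apply_apply] at h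
    simpa using h.symm
  · ext x
    have h := hfun i (χ.symm (Pi.mulSingle i x, 1))
    rw [hfun' i, χ.apply_symm_apply] at h
    simpa using h.symm

end Factors

theorem surjective_torsionFreeAbelianizationProj (G : Type*) [Group G] :
    Function.Surjective (torsionFreeAbelianizationProj G) :=
  (QuotientGroup.mk'_surjective _).comp (QuotientGroup.mk'_surjective _)

/-- Homomorphisms to torsion-free abelian groups factor through the quotient of the abelianization
by its torsion subgroup. -/
theorem exists_comp_torsionFreeAbelianizationProj_eq {G A : Type*} [Group G] [CommGroup A]
    [IsMulTorsionFree A] (f : G →* A) :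
    ∃ F : TorsionFreeAbelianization G →* A, ∀ g, F (torsionFreeAbelianizationProj G g) = f g := by
  refine ⟨QuotientGroup.lift _ (Abelianization.lift f) fun x hx => ?_, fun g => rfl⟩
  have h := CommGroup.le_comap_torsion (Abelianization.lift f) hx
  rwa [CommGroup.isMulTorsionFree_iff_torsion_eq_bot.1 inferInstance, Subgroup.mem_comap,
    Subgroup.mem_bot] at h

theorem closure_range_ofAdd_single_eq_top (ι : Type*) [Finite ι] [DecidableEq ι] :
    Subgroup.closure (Set.range fun j : ι => Multiplicative.ofAdd (Pi.single j (1 : ℤ))) = ⊤ := by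
  have := Fintype.ofFinite ι
  rw [eq_top_iff]
  intro a _
  have h : a = ∏ j, Multiplicative.ofAdd (Pi.single j (1 : ℤ) : ι → ℤ) ^ (a.toAdd j) := by
    apply Multiplicative.toAdd.injective
    rw [toAdd_prod]
    ext i
    simp [Finset.sum_apply, Pi.single_apply]
  rw [h]
  exact Subgroup.prod_mem _ fun j _ =>
    Subgroup.zpow_mem _ (Subgroup.subset_closure (Set.mem_range_self j)) _

/-- Conjugacy growth of an automorphism `χ` of `G = G₁ × ⋯ × G_k × ℤᵐ` (each `Gᵢ` finitely
generated, directly indecomposable, with trivial center) preserving each canonical factor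
`Hᵢ ≅ Gᵢ × ℤᵐ`: there are automorphisms `φᵢ` of the `Gᵢ` such that, up to a multiplicative
constant, `‖χⁿ(g)‖_S = Σᵢ ‖φᵢⁿ(gᵢ)‖_{Sᵢ} + |χ̄ⁿ(q(g))|`, where `q` is the projection onto
the abelianization of `G` modulo torsion and `χ̄` the induced automorphism; moreover for
each `g` with `q(g) ≠ 1` the sequence `n ↦ |χ̄ⁿ(q(g))|` is equivalent to `nᵖ·λⁿ` for some
`p ∈ ℕ` and a real algebraic integer `λ ≥ 1`. -/
theorem conjugacy_growth_of_automorphism_of_direct_product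
    (k m : ℕ) (G : Fin k → Type*) [∀ i, Group (G i)]
    (Si : ∀ i, Finset (G i))
    (hgenSi : ∀ i, Subgroup.closure ((Si i : Set (G i))) = ⊤)
    (hcenter : ∀ i, Subgroup.center (G i) = ⊥)
    (hindec : ∀ i, ∀ P Q : Subgroup (G i), P.Normal → Q.Normal → P ⊓ Q = ⊥ →
      (∀ g : G i, ∃ x ∈ P, ∃ y ∈ Q, g = x * y) → P = ⊥ ∨ Q = ⊥)
    (S : Finset ((∀ i, G i) × Multiplicative (Fin m → ℤ)))
    (hS : ∀ x : (∀ i, G i) × Multiplicative (Fin m → ℤ), x ∈ S ↔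
      ((∃ i, ∃ s ∈ Si i, x = (Pi.mulSingle i s, 1)) ∨
        ∃ j : Fin m, x = (1, Multiplicative.ofAdd (Pi.single j (1 : ℤ))) ∨
          x = (1, Multiplicative.ofAdd (-Pi.single j (1 : ℤ)))))
    (χ : ((∀ i, G i) × Multiplicative (Fin m → ℤ)) ≃*
      ((∀ i, G i) × Multiplicative (Fin m → ℤ)))
    (hχ : ∀ i : Fin k,
      ⇑χ '' {x : (∀ i, G i) × Multiplicative (Fin m → ℤ) | ∀ j, j ≠ i → x.1 j = 1} =
        {x : (∀ i, G i) × Multiplicative (Fin m → ℤ) | ∀ j, j ≠ i → x.1 j = 1})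
    (q : ((∀ i, G i) × Multiplicative (Fin m → ℤ)) →*
      TorsionFreeAbelianization ((∀ i, G i) × Multiplicative (Fin m → ℤ)))
    (hq : q = torsionFreeAbelianizationProj _) :
    ∃ φ : ∀ i, G i ≃* G i,
      ∀ χbar : TorsionFreeAbelianization ((∀ i, G i) × Multiplicative (Fin m → ℤ)) ≃*
          TorsionFreeAbelianization ((∀ i, G i) × Multiplicative (Fin m → ℤ)),
        (∀ g, χbar (q g) = q (χ g)) →
        (∃ C : ℝ, 1 ≤ C ∧
          ∀ (g : (∀ i, G i) × Multiplicative (Fin m → ℤ)) (n : ℕ),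
            C⁻¹ * ((∑ i, (conjLength (Si i : Set (G i)) ((⇑(φ i))^[n] (g.1 i)) : ℝ)) +
                (wordLength (⇑q '' (S : Set ((∀ i, G i) × Multiplicative (Fin m → ℤ))))
                  ((⇑χbar)^[n] (q g)) : ℝ)) ≤
              (conjLength (S : Set ((∀ i, G i) × Multiplicative (Fin m → ℤ)))
                ((⇑χ)^[n] g) : ℝ) ∧
            (conjLength (S : Set ((∀ i, G i) × Multiplicative (Fin m → ℤ)))
                ((⇑χ)^[n] g) : ℝ) ≤
              C * ((∑ i, (conjLength (Si i : Set (G i)) ((⇑(φ i))^[n] (g.1 i)) : ℝ)) +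
                (wordLength (⇑q '' (S : Set ((∀ i, G i) × Multiplicative (Fin m → ℤ))))
                  ((⇑χbar)^[n] (q g)) : ℝ))) ∧
        (∀ g : (∀ i, G i) × Multiplicative (Fin m → ℤ), q g ≠ 1 →
          ∃ (p : ℕ) (lam : ℝ), 1 ≤ lam ∧ IsIntegral ℤ lam ∧
            ∃ C : ℝ, 0 < C ∧ ∀ n : ℕ, 1 ≤ n →
              (wordLength (⇑q '' (S : Set ((∀ i, G i) × Multiplicative (Fin m → ℤ))))
                  ((⇑χbar)^[n] (q g)) : ℝ) ≤ C * ((n : ℝ) ^ p * lam ^ n) ∧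
              (n : ℝ) ^ p * lam ^ n ≤
                C * (wordLength (⇑q '' (S : Set ((∀ i, G i) × Multiplicative (Fin m → ℤ))))
                  ((⇑χbar)^[n] (q g)) : ℝ)) := by
  obtain ⟨φ, hφ⟩ := exists_mulEquiv_apply_fst_eq hcenter χ hχ
  refine ⟨φ, fun χbar hχbar => ?_⟩
  let T : Set (Multiplicative (Fin m → ℤ)) :=
    (Set.range fun j : Fin m => Multiplicative.ofAdd (Pi.single j (1 : ℤ))) ∪
      Set.range fun j : Fin m => Multiplicative.ofAdd (-Pi.single j (1 : ℤ))
  have hT : Subgroup.closure T = ⊤ := by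
    rw [eq_top_iff, ← closure_range_ofAdd_single_eq_top (Fin m)]
    exact Subgroup.closure_mono Set.subset_union_left
  have hSiS : ∀ i, ∀ s ∈ (Si i : Set (G i)),
      ((Pi.mulSingle i s, 1) : (∀ i, G i) × Multiplicative (Fin m → ℤ)) ∈
        (S : Set ((∀ i, G i) × Multiplicative (Fin m → ℤ))) :=
    fun i s hs => (hS _).2 (Or.inl ⟨i, s, hs, rfl⟩)
  have hTS : ∀ t ∈ T, ((1, t) : (∀ i, G i) × Multiplicative (Fin m → ℤ)) ∈
      (S : Set ((∀ i, G i) × Multiplicative (Fin m → ℤ))) := by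
    rintro _ (⟨j, rfl⟩ | ⟨j, rfl⟩)
    · exact (hS _).2 (Or.inr ⟨j, Or.inl rfl⟩)
    · exact (hS _).2 (Or.inr ⟨j, Or.inr rfl⟩)
  have hgenS := closure_pi_prod_eq_top hgenSi hT hSiS hTS
  have hqsurj : Function.Surjective q := hq ▸ surjective_torsionFreeAbelianizationProj _
  have hgenq : Subgroup.closure (⇑q '' (S : Set _)) = ⊤ := by
    rw [← MonoidHom.map_closure, hgenS, ← MonoidHom.range_eq_map,
      MonoidHom.range_eq_top_of_surjective q hqsurj]
  have hiter : ∀ n g, (⇑χbar)^[n] (q g) = q ((⇑χ)^[n] g) := fun n g =>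
    (Function.Semiconj.iterate_right (f := q) (fun x => (hχbar x).symm) n g).symm
  have hiterφ : ∀ n g i, (⇑(φ i))^[n] (g.1 i) = ((⇑χ)^[n] g).1 i := fun n g i =>
    (Function.Semiconj.iterate_right (f := fun x : (∀ i, G i) × Multiplicative (Fin m → ℤ) => x.1 i)
      (fun x => hφ x i) n g).symm
  have hupper : ∀ h, conjLength (S : Set _) h ≤
      ∑ i, conjLength (Si i : Set (G i)) (h.1 i) + wordLength (⇑q '' (S : Set _)) (q h) :=
    fun h => by
    refine (conjLength_pi_prod_le hgenSi hT hgenS hSiS hTS h).trans (Nat.add_le_add_left ?_ _)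
    obtain ⟨F, hF⟩ := exists_comp_torsionFreeAbelianizationProj_eq
      (MonoidHom.snd (∀ i, G i) (Multiplicative (Fin m → ℤ)))
    rw [← hq] at hF
    rw [← show F (q h) = h.2 from hF h]
    refine wordLength_map_le hgenq F ?_ (q h)
    rintro _ ⟨s, hs, rfl⟩
    rw [hF]
    rcases (hS s).1 hs with ⟨i, t, _, rfl⟩ | ⟨j, rfl | rfl⟩
    · exact Or.inr rfl
    · exact Or.inl (Or.inl ⟨j, rfl⟩)
    · exact Or.inl (Or.inr ⟨j, rfl⟩)
  have hlower : ∀ h,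
      ∑ i, conjLength (Si i : Set (G i)) (h.1 i) + wordLength (⇑q '' (S : Set _)) (q h) ≤
      (k + 1) * conjLength (S : Set _) h := fun h => by
    have h1 : ∀ i, conjLength (Si i : Set (G i)) (h.1 i) ≤ conjLength (S : Set _) h := fun i => by
      refine conjLength_map_le hgenS ((Pi.evalMonoidHom G i).comp (MonoidHom.fst _ _))
        (fun s hs => ?_) h
      rcases (hS s).1 hs with ⟨j, t, ht, rfl⟩ | ⟨j, rfl | rfl⟩
      · by_cases hij : i = j
        · subst hij
          exact Or.inl (by simpa using ht)
        · exact Or.inr (by simp [hij])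
      · exact Or.inr rfl
      · exact Or.inr rfl
    have h2 : wordLength (⇑q '' (S : Set _)) (q h) ≤ conjLength (S : Set _) h := by
      rw [← conjLength_eq_wordLength]
      exact conjLength_map_le hgenS q (fun s hs => Or.inl (Set.mem_image_of_mem q hs)) h
    rw [add_mul, one_mul]
    refine add_le_add ((Finset.sum_le_sum fun i _ => h1 i).trans ?_) h2
    simp
  refine ⟨⟨k + 1, by simp, fun g n => ?_⟩, fun g hg =>
    exists_bilipschitz_wordLength_iterate (S.finite_toSet.image q) hgenq χbar hg⟩
  simp_rw [hiter, hiterφ]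
  have h1 := hupper ((⇑χ)^[n] g)
  have h2 := hlower ((⇑χ)^[n] g)
  rify at h1 h2
  refine ⟨(inv_mul_le_iff₀ (by positivity)).2 h2, h1.trans ?_⟩
  exact le_mul_of_one_le_left (by positivity) (by simp)
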